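/- Suppose two trains k₁ and k₂ travel in opposite directions over a section between nodes i and j, train k₁ from i to j and train k₂ from j to i, and suppose the time bounds fix the sequence at node i to 'k₁ departs i before k₂ arrives at i' and fix the sequence at node j to 'k₂ departs j before k₁ arrives at j'. If each train's position along the section is a continuous function of time moving from its entry node to its exit node, then there exists a time at which the two trains occupy the same position on the section; hence routing both trains on the same single track of this section is infeasible (a collision occurs), and at most one of the two trains may be assigned to that track. -/

import Mathlib

/-- Two trains travel a section between nodes `i` and `j` in opposite directions
on the same single track: train `k₁` from `i` (position `0`) to `j` (position `1`)
during `[dep₁, arr₁]`, and train `k₂` from `j` (position `1`) to `i` (position `0`)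
during `[dep₂, arr₂]`.  Each train's position is a continuous function of time
taking values in `[0, 1]` during its travel.  If the time bounds fix the sequence
at node `i` (`k₁` departs `i` before `k₂` arrives at `i`, i.e. `dep₁ < arr₂`) and
at node `j` (`k₂` departs `j` before `k₁` arrives at `j`, i.e. `dep₂ < arr₁`),
then there is a time at which both trains occupy the same position on the
section — a collision — so at most one of them may be assigned to that track. -/
theorem opposite_direction_same_track_collision
    (dep₁ arr₁ dep₂ arr₂ : ℝ) (pos₁ pos₂ : ℝ → ℝ)
    (ht₁ : dep₁ ≤ arr₁) (ht₂ : dep₂ ≤ arr₂)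
    (hseq_i : dep₁ < arr₂) (hseq_j : dep₂ < arr₁)
    (hc₁ : ContinuousOn pos₁ (Set.Icc dep₁ arr₁))
    (hc₂ : ContinuousOn pos₂ (Set.Icc dep₂ arr₂))
    (hstart₁ : pos₁ dep₁ = 0) (hend₁ : pos₁ arr₁ = 1)
    (hstart₂ : pos₂ dep₂ = 1) (hend₂ : pos₂ arr₂ = 0)
    (hrange₁ : ∀ t ∈ Set.Icc dep₁ arr₁, pos₁ t ∈ Set.Icc (0 : ℝ) 1)
    (hrange₂ : ∀ t ∈ Set.Icc dep₂ arr₂, pos₂ t ∈ Set.Icc (0 : ℝ) 1) :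
    ∃ t ∈ Set.Icc dep₁ arr₁ ∩ Set.Icc dep₂ arr₂, pos₁ t = pos₂ t := by
  have hle : max dep₁ dep₂ ≤ min arr₁ arr₂ :=
    max_le (le_min ht₁ hseq_i.le) (le_min hseq_j.le ht₂)
  rw [Set.Icc_inter_Icc]
  have hmem₁ : Set.Icc (max dep₁ dep₂) (min arr₁ arr₂) ⊆ Set.Icc dep₁ arr₁ :=
    Set.Icc_subset_Icc (le_max_left _ _) (min_le_left _ _)
  have hmem₂ : Set.Icc (max dep₁ dep₂) (min arr₁ arr₂) ⊆ Set.Icc dep₂ arr₂ :=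
    Set.Icc_subset_Icc (le_max_right _ _) (min_le_right _ _)
  have hl := Set.left_mem_Icc.2 hle
  have hr := Set.right_mem_Icc.2 hle
  have hstart : pos₁ (max dep₁ dep₂) ≤ pos₂ (max dep₁ dep₂) := by
    have h₁ := hrange₁ _ (hmem₁ hl)
    have h₂ := hrange₂ _ (hmem₂ hl)
    rcases max_choice dep₁ dep₂ with h | h <;> rw [h] at h₁ h₂ ⊢
    · exact hstart₁.trans_le h₂.1
    · exact h₁.2.trans_eq hstart₂.symm
  have hend : pos₂ (min arr₁ arr₂) ≤ pos₁ (min arr₁ arr₂) := by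
    have h₁ := hrange₁ _ (hmem₁ hr)
    have h₂ := hrange₂ _ (hmem₂ hr)
    rcases min_choice arr₁ arr₂ with h | h <;> rw [h] at h₁ h₂ ⊢
    · exact h₂.2.trans_eq hend₁.symm
    · exact hend₂.trans_le h₁.1
  exact isPreconnected_Icc.intermediate_value₂ hl hr (hc₁.mono hmem₁) (hc₂.mono hmem₂)
    hstart hend
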